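/- Let A ∗_C B be the amalgamated free product of finitely generated groups A and B over a common subgroup C, with the word metric from a finite generating set S = S_A ∪ S_B. Suppose asdim A ≤ n and asdim B ≤ n. Then for every m, the subset (BA)^m = BA⋯BA ⊆ A ∗_C B (the set of products b₁a₁⋯b_m a_m with b_j ∈ B, a_j ∈ A), equipped with the induced metric, satisfies asdim (BA)^m ≤ n. -/

import Mathlib

/-- `AsdimOnLE dist A n` : the subset `A` of a space with distance function `dist`,
equipped with the induced metric, has asymptotic dimension at most `n`. -/
def AsdimOnLE {X : Type*} (dist : X → X → ℝ) (A : Set X) (n : ℕ) : Prop :=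
  ∀ d : ℝ, 0 < d → ∃ R : ℝ, ∃ 𝒰 : Fin (n + 1) → Set (Set X),
    (∀ i, ∀ U ∈ 𝒰 i, U ⊆ A) ∧
    (∀ x ∈ A, ∃ i, ∃ U ∈ 𝒰 i, x ∈ U) ∧
    (∀ i, ∀ U ∈ 𝒰 i, ∀ V ∈ 𝒰 i, U ≠ V → ∀ x ∈ U, ∀ y ∈ V, d ≤ dist x y) ∧
    (∀ i, ∀ U ∈ 𝒰 i, ∀ x ∈ U, ∀ y ∈ U, dist x y ≤ R)

/-- The word norm of `x` with respect to the alphabet `S ∪ S⁻¹`. -/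
noncomputable def wordNorm {G : Type*} [Group G] (S : Set G) (x : G) : ℕ :=
  sInf {n : ℕ | ∃ l : List G, l.length = n ∧ (∀ g ∈ l, g ∈ S ∨ g⁻¹ ∈ S) ∧ l.prod = x}

/-- The left-invariant word metric `d_S(x,y) = ‖x⁻¹y‖_S`. -/
noncomputable def wordDist {G : Type*} [Group G] (S : Set G) (x y : G) : ℝ :=
  (wordNorm S (x⁻¹ * y) : ℝ)


namespace AsdimAux

open Relation

section Abstract

variable {X : Type*}

/-- one monochromatic `d`-step inside `A` -/
def St {k : ℕ} (D : X → X → ℕ) (A : Set X) (c : X → Fin k) (d : ℕ) (x y : X) : Prop :=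
  x ∈ A ∧ y ∈ A ∧ c x = c y ∧ D x y ≤ d

/-- monochromatic `d`-chains inside `A` -/
def Chn {k : ℕ} (D : X → X → ℕ) (A : Set X) (c : X → Fin k) (d : ℕ) : X → X → Prop :=
  ReflTransGen (St D A c d)

def AD (D : X → X → ℕ) (A : Set X) (n : ℕ) : Prop :=
  ∀ d : ℕ, ∃ R : ℕ, ∃ c : X → Fin (n + 1), ∀ x y, Chn D A c d x y → D x y ≤ R

def UAD {ι : Type*} (D : X → X → ℕ) (F : ι → Set X) (n : ℕ) : Prop :=
  ∀ d : ℕ, ∃ R : ℕ, ∃ c : ι → X → Fin (n + 1), ∀ α x y, Chn D (F α) (c α) d x y → D x y ≤ R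

lemma Chn.color {k : ℕ} {D : X → X → ℕ} {A : Set X} {c : X → Fin k} {d : ℕ} {x y : X}
    (h : Chn D A c d x y) : c x = c y := by
  induction h with
  | refl => rfl
  | tail _ h ih => exact ih.trans h.2.2.1

lemma Chn.mem {k : ℕ} {D : X → X → ℕ} {A : Set X} {c : X → Fin k} {d : ℕ} {x y : X}
    (h : Chn D A c d x y) (hx : x ∈ A) : y ∈ A := by
  induction h with
  | refl => exact hx
  | tail _ h ih => exact h.2.1

lemma AD.mono {D : X → X → ℕ} {A B : Set X} {n : ℕ} (hB : AD D B n) (h : A ⊆ B) : AD D A n := by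
  intro d
  obtain ⟨R, c, hc⟩ := hB d
  refine ⟨R, c, fun x y hxy => hc x y ?_⟩
  exact ReflTransGen.mono (r := St D A c d) (fun a b hab => ⟨h hab.1, h hab.2.1, hab.2.2⟩) _ _ hxy

lemma AD_of_asdim {D : X → X → ℕ} (h0 : ∀ x, D x x = 0) {A : Set X} {n : ℕ}
    (h : AsdimOnLE (fun x y => (D x y : ℝ)) A n) : AD D A n := by
  classical
  intro d
  obtain ⟨R, U, h1, h2, h3, h4⟩ := h (d + 1) (by positivity)
  choose! c V hV hxV using h2
  refine ⟨⌈R⌉₊, c, fun x y hxy => ?_⟩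
  by_cases hx : x ∈ A
  · have : V y = V x := by
      induction hxy with
      | refl => rfl
      | @tail a b h hab ih =>
        obtain ⟨ha, hb, hc, hd⟩ := hab
        rw [← ih]
        by_contra hne
        have := h3 (c a) (V b) (hc ▸ hV b hb) (V a) (hV a ha) hne
        have h5 := h3 (c a) (V a) (hV a ha) (V b) (hc ▸ hV b hb) (Ne.symm hne) a (hxV a ha) b
          (hxV b hb)
        have : (d : ℝ) + 1 ≤ d := h5.trans (Nat.cast_le.2 hd)
        linarith
    have hy := hxy.mem hx
    have h6 := h4 (c x) (V x) (hV x hx) x (hxV x hx) y (this ▸ hxV y hy)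
    exact Nat.cast_le.1 (h6.trans (Nat.le_ceil R))
  · have : x = y := by
      rcases ReflTransGen.cases_head hxy with h | ⟨z, hz, _⟩
      · exact h
      · exact absurd hz.1 hx
    subst this
    simp [h0]

lemma asdim_of_AD {D : X → X → ℕ} (hs : ∀ x y, D x y = D y x) {A : Set X} {n : ℕ}
    (h : AD D A n) : AsdimOnLE (fun x y => (D x y : ℝ)) A n := by
  intro d hd
  obtain ⟨R, c, hc⟩ := h ⌈d⌉₊
  have symm : ∀ x y, Chn D A c ⌈d⌉₊ x y → Chn D A c ⌈d⌉₊ y x := by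
    intro x y h
    induction h with
    | refl => exact ReflTransGen.refl
    | tail _ hab ih =>
      obtain ⟨h1, h2, h3, h4⟩ := hab
      exact ReflTransGen.head ⟨h2, h1, h3.symm, by rwa [hs]⟩ ih
  refine ⟨R, fun i => {U | ∃ x ∈ A, c x = i ∧ U = {y | Chn D A c ⌈d⌉₊ x y}}, ?_, ?_, ?_, ?_⟩
  · rintro i U ⟨x, hx, rfl, rfl⟩ y hy
    exact Chn.mem hy hx
  · intro x hx
    exact ⟨c x, _, ⟨x, hx, rfl, rfl⟩, ReflTransGen.refl⟩
  · rintro i U ⟨x, hx, hxi, rfl⟩ V ⟨y, hy, hyi, rfl⟩ hne a ha b hb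
    by_contra hlt
    push Not at hlt
    apply hne
    have ha' : Chn D A c ⌈d⌉₊ x a := ha
    have hb' : Chn D A c ⌈d⌉₊ y b := hb
    have hab : Chn D A c ⌈d⌉₊ a b := by
      refine ReflTransGen.single ⟨ha'.mem hx, hb'.mem hy, ?_, ?_⟩
      · rw [← ha'.color, ← hb'.color, hxi, hyi]
      · exact_mod_cast hlt.le.trans (Nat.le_ceil d)
    have hxy : Chn D A c ⌈d⌉₊ x y := ha'.trans (hab.trans (symm _ _ hb'))
    ext z
    exact ⟨fun hz => (symm _ _ hxy).trans hz, fun hz => hxy.trans hz⟩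
  · rintro i U ⟨x, hx, hxi, rfl⟩ a ha b hb
    exact Nat.cast_le.2 <| hc a b ((symm _ _ ha).trans hb)

lemma AD.thicken {D : X → X → ℕ} (hs : ∀ x y, D x y = D y x)
    (h0 : ∀ x, D x x = 0)
    (ht : ∀ x y z, D x z ≤ D x y + D y z) {A : Set X} {n : ℕ} (h : AD D A n) (r : ℕ) :
    AD D {x | ∃ a ∈ A, D a x ≤ r} n := by
  classical
  intro d
  obtain ⟨R, c, hc⟩ := h (d + 2 * r)
  have : ∀ x, ∃ a, (∃ a ∈ A, D a x ≤ r) → a ∈ A ∧ D a x ≤ r := by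
    intro x
    by_cases hx : ∃ a ∈ A, D a x ≤ r
    · obtain ⟨a, ha⟩ := hx
      exact ⟨a, fun _ => ha⟩
    · exact ⟨x, fun h => absurd h hx⟩
  choose p hp using this
  refine ⟨R + 2 * r, fun x => c (p x), fun x y hxy => ?_⟩
  by_cases hx : ∃ a ∈ A, D a x ≤ r
  · have hy : ∃ a ∈ A, D a y ≤ r := hxy.mem hx
    have key : Chn D A c (d + 2 * r) (p x) (p y) := by
      refine ReflTransGen.lift p ?_ _ _ hxy
      rintro a b ⟨ha, hb, hcc, hd⟩
      refine ⟨(hp a ha).1, (hp b hb).1, hcc, ?_⟩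
      have h1 := (hp a ha).2
      have h2 := (hp b hb).2
      have h3 := ht (p a) a (p b)
      have h4 := ht a b (p b)
      rw [hs b (p b)] at h4
      omega
    have h1 := (hp x hx).2
    have h2 := (hp y hy).2
    have h3 := ht x (p x) y
    have h4 := ht (p x) (p y) y
    rw [hs x (p x)] at h3
    have h5 := hc _ _ key
    omega
  · rcases ReflTransGen.cases_head hxy with h | ⟨z, hz, _⟩
    · subst h; simp [h0]
    · exact absurd hz.1 hx

lemma AD_union {ι : Type*} {D : X → X → ℕ}
    (h0 : ∀ x, D x x = 0) (ht : ∀ x y z, D x z ≤ D x y + D y z) {n : ℕ}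
    (A : Set X) (Y : ℕ → Set X) (hY : ∀ d, AD D (Y d) n) (F : ι → Set X) (hF : UAD D F n)
    (hcov : ∀ d, ∀ x ∈ A, x ∉ Y d → ∃ α, x ∈ F α)
    (hdis : ∀ d x y α β, x ∉ Y d → y ∉ Y d → x ∈ F α → y ∈ F β → D x y ≤ d → α = β) :
    AD D A n := by
  classical
  intro d
  obtain ⟨R, cF, hcF⟩ := hF d
  obtain ⟨R', cY, hcY⟩ := hY d (R + 2 * d)
  set c : X → Fin (n + 1) := fun x => if x ∈ Y d then cY x else
    if h : ∃ α, x ∈ F α then cF h.choose x else 0 with hc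
  have cin : ∀ x ∈ Y d, c x = cY x := fun x hx => by simp [hc, hx]
  have cout : ∀ x ∉ Y d, ∀ α, x ∈ F α → c x = cF α x := by
    intro x hx α hα
    have h : ∃ α, x ∈ F α := ⟨α, hα⟩
    have : h.choose = α := hdis d x x _ _ hx hx h.choose_spec hα (by simp [h0])
    simp only [hc, hx, if_false, dif_pos h, this]
  have UC : ∀ x y, Chn D (A \ Y d) c d x y → D x y ≤ R := by
    intro x y hxy
    rcases ReflTransGen.cases_head hxy with h | ⟨z, hz, hzz⟩
    · subst h; simp [h0]
    · have hx := hz.1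
      clear hzz
      obtain ⟨α, hα⟩ := hcov d x hx.1 hx.2
      apply hcF α
      suffices y ∈ F α ∧ Chn D (F α) (cF α) d x y from this.2
      clear hz
      induction hxy with
      | refl => exact ⟨hα, ReflTransGen.refl⟩
      | @tail a b h hab ih =>
        obtain ⟨ha, hb, hcc, hd⟩ := hab
        obtain ⟨β, hβ⟩ := hcov d b hb.1 hb.2
        obtain rfl : α = β := hdis d a b _ _ ha.2 hb.2 ih.1 hβ hd
        refine ⟨hβ, ih.2.tail ⟨ih.1, hβ, ?_, hd⟩⟩
        rw [← cout a ha.2 α ih.1, ← cout b hb.2 α hβ, hcc]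
  refine ⟨(R + d) + R' + (R + d), c, fun x y hxy => ?_⟩
  have P : (y ∉ Y d ∧ Chn D (A \ Y d) c d x y) ∨
      ∃ p q, q ∈ Y d ∧ D x p ≤ R + d ∧ Chn D (Y d) cY (R + 2 * d) p q ∧ c q = c y ∧
        (q = y ∨ (y ∉ Y d ∧ ∃ z, D q z ≤ d ∧ Chn D (A \ Y d) c d z y)) := by
    induction hxy with
    | refl =>
      by_cases hx : x ∈ Y d
      · exact Or.inr ⟨x, x, hx, by simp [h0], ReflTransGen.refl, rfl, Or.inl rfl⟩
      · exact Or.inl ⟨hx, ReflTransGen.refl⟩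
    | @tail a b h hab ih =>
      obtain ⟨ha, hb, hcc, hd⟩ := hab
      rcases ih with ⟨haY, hch⟩ | ⟨p, q, hq, hxp, hpq, hcq, rfl | ⟨haY, z, hqz, hch⟩⟩
      · by_cases hbY : b ∈ Y d
        · refine Or.inr ⟨b, b, hbY, ?_, ReflTransGen.refl, rfl, Or.inl rfl⟩
          have := UC _ _ hch
          have := ht x a b
          omega
        · exact Or.inl ⟨hbY, hch.tail ⟨⟨ha, haY⟩, ⟨hb, hbY⟩, hcc, hd⟩⟩
      · by_cases hbY : b ∈ Y d
        · refine Or.inr ⟨p, b, hbY, hxp, hpq.tail ⟨hq, hbY, ?_, by omega⟩, rfl, Or.inl rfl⟩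
          rw [← cin _ hq, ← cin _ hbY, hcc]
        · exact Or.inr ⟨p, q, hq, hxp, hpq, hcc, Or.inr ⟨hbY, b, hd, ReflTransGen.refl⟩⟩
      · by_cases hbY : b ∈ Y d
        · refine Or.inr ⟨p, b, hbY, hxp, hpq.tail ⟨hq, hbY, ?_, ?_⟩, rfl, Or.inl rfl⟩
          · rw [← cin _ hq, ← cin _ hbY, hcq, hcc]
          · have := UC _ _ hch
            have := ht q z b
            have := ht z a b
            omega
        · exact Or.inr ⟨p, q, hq, hxp, hpq, hcq.trans hcc, Or.inr ⟨hbY, z, hqz,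
            hch.tail ⟨⟨ha, haY⟩, ⟨hb, hbY⟩, hcc, hd⟩⟩⟩
  rcases P with ⟨_, h⟩ | ⟨p, q, hq, hxp, hpq, hcq, rfl | ⟨haY, z, hqz, hch⟩⟩
  · have := UC _ _ h
    omega
  · have := hcY _ _ hpq
    have := ht x p q
    omega
  · have := hcY _ _ hpq
    have := ht x p q
    have := UC _ _ hch
    have := ht x q y
    have := ht q z y
    omega

end Abstract

section Norm

variable {G : Type*} [Group G]

lemma wordNorm_le {S : Set G} (l : List G) (hl : ∀ g ∈ l, g ∈ S ∨ g⁻¹ ∈ S) :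
    wordNorm S l.prod ≤ l.length :=
  Nat.sInf_le ⟨l, rfl, hl, rfl⟩

lemma exists_word {S : Set G} (hS : Subgroup.closure S = ⊤) (x : G) :
    ∃ l : List G, l.length = wordNorm S x ∧ (∀ g ∈ l, g ∈ S ∨ g⁻¹ ∈ S) ∧ l.prod = x := by
  have : {n : ℕ | ∃ l : List G, l.length = n ∧ (∀ g ∈ l, g ∈ S ∨ g⁻¹ ∈ S) ∧ l.prod = x}.Nonempty := by
    obtain ⟨l, hl, h⟩ := Submonoid.exists_list_of_mem_closure (s := S ∪ S⁻¹) (x := x) (by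
      rw [← Subgroup.closure_toSubmonoid, hS]; trivial)
    exact ⟨_, l, rfl, fun g hg => by simpa using hl g hg, h⟩
  exact Nat.sInf_mem this

lemma wordNorm_one (S : Set G) : wordNorm S (1 : G) = 0 := by
  have := wordNorm_le (S := S) [] (by simp)
  simpa using this

lemma wordNorm_mul {S : Set G} (hS : Subgroup.closure S = ⊤) (x y : G) :
    wordNorm S (x * y) ≤ wordNorm S x + wordNorm S y := by
  obtain ⟨l, h1, h2, h3⟩ := exists_word hS x
  obtain ⟨l', h1', h2', h3'⟩ := exists_word hS y
  have := wordNorm_le (S := S) (l ++ l') (by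
    intro g hg
    rcases List.mem_append.1 hg with h | h
    exacts [h2 g h, h2' g h])
  simpa [h1, h1', h3, h3'] using this

lemma wordNorm_inv_le {S : Set G} (hS : Subgroup.closure S = ⊤) (x : G) :
    wordNorm S x⁻¹ ≤ wordNorm S x := by
  obtain ⟨l, h1, h2, h3⟩ := exists_word hS x
  have := wordNorm_le (S := S) (l.map (·⁻¹)).reverse (by
    intro g hg
    simp only [List.mem_reverse, List.mem_map] at hg
    obtain ⟨a, ha, rfl⟩ := hg
    rw [inv_inv]
    exact (h2 a ha).symm)
  rw [← List.prod_inv_reverse, h3] at this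
  simpa [h1] using this

lemma ball_finite {S : Set G} (hS : Subgroup.closure S = ⊤) (hf : S.Finite) (d : ℕ) :
    {x | wordNorm S x ≤ d}.Finite := by
  have hT : (S ∪ S⁻¹).Finite := hf.union hf.inv
  have h1 : {l : List G | l.length ≤ d ∧ ∀ g ∈ l, g ∈ S ∪ S⁻¹}.Finite := by
    have := hT.to_subtype
    refine ((List.finite_length_le (↥(S ∪ S⁻¹)) d).image (List.map Subtype.val)).subset ?_
    rintro l ⟨h, h'⟩
    refine ⟨l.attach.map fun g => ⟨g.1, h' g.1 g.2⟩, by simpa using h, ?_⟩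
    simp
  refine (h1.image List.prod).subset ?_
  intro x hx
  obtain ⟨l, h1, h2, h3⟩ := exists_word hS x
  exact ⟨l, ⟨h1.trans_le hx, fun g hg => by simpa using h2 g hg⟩, h3⟩

/-- natural number valued word distance -/
noncomputable def nd (S : Set G) (x y : G) : ℕ := wordNorm S (x⁻¹ * y)

lemma nd_self (S : Set G) (x : G) : nd S x x = 0 := by simp [nd, wordNorm_one]

lemma nd_comm {S : Set G} (hS : Subgroup.closure S = ⊤) (x y : G) : nd S x y = nd S y x := by
  apply le_antisymm
  · have := wordNorm_inv_le hS (y⁻¹ * x)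
    simpa [nd] using this
  · have := wordNorm_inv_le hS (x⁻¹ * y)
    simpa [nd] using this

lemma nd_tri {S : Set G} (hS : Subgroup.closure S = ⊤) (x y z : G) :
    nd S x z ≤ nd S x y + nd S y z := by
  have := wordNorm_mul hS (x⁻¹ * y) (y⁻¹ * z)
  simpa [nd, mul_assoc] using this

lemma wordNorm_map_le {H : Type*} [Group H] (f : G →* H) {S : Set G} {T : Set H}
    (hS : Subgroup.closure S = ⊤) (hST : f '' S ⊆ T) (x : G) :
    wordNorm T (f x) ≤ wordNorm S x := by
  obtain ⟨l, h1, h2, h3⟩ := exists_word hS x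
  have := wordNorm_le (S := T) (l.map f) (by
    intro g hg
    obtain ⟨a, ha, rfl⟩ := List.mem_map.1 hg
    rw [← map_inv]
    exact (h2 a ha).imp (fun h => hST ⟨a, h, rfl⟩) (fun h => hST ⟨_, h, rfl⟩))
  rw [← map_list_prod, h3] at this
  simpa [h1] using this

lemma UAD_cosets {J : Type*} [Finite J] {K : J → Type*} [∀ j, Group (K j)] (f : ∀ j, K j →* G)
    (hf : ∀ j, Function.Injective (f j)) (S : ∀ j, Set (K j))
    (hS : ∀ j, Subgroup.closure (S j) = ⊤) {T : Set G} (hT : Subgroup.closure T = ⊤)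
    (hTf : T.Finite) (hST : ∀ j, f j '' S j ⊆ T) {n : ℕ}
    (hA : ∀ j, AD (nd (S j)) Set.univ n) {ι : Type*} (F : ι → Set G) (idx : ι → J)
    (hF : ∀ α, ∀ x ∈ F α, ∀ y ∈ F α, ∃ g, x⁻¹ * y = f (idx α) g) :
    UAD (nd T) F n := by
  classical
  intro d
  have hb : ∀ j, ∃ e, ∀ g, wordNorm T (f j g) ≤ d → wordNorm (S j) g ≤ e := by
    intro j
    have h1 : {g | wordNorm T (f j g) ≤ d}.Finite :=
      (ball_finite hT hTf d).preimage (hf j).injOn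
    obtain ⟨e, he⟩ := (h1.image (wordNorm (S j))).bddAbove
    exact ⟨e, fun g hg => he ⟨g, hg, rfl⟩⟩
  choose e he using hb
  choose R c hc using fun j => hA j (e j)
  obtain ⟨M, hM⟩ := (Set.finite_range R).bddAbove
  have hp : ∀ α, ∃ p : G → K (idx α), ∀ x ∈ F α, ∀ y ∈ F α, x⁻¹ * y = f _ ((p x)⁻¹ * p y) := by
    intro α
    by_cases hne : (F α).Nonempty
    · obtain ⟨x0, hx0⟩ := hne
      have := fun x (hx : x ∈ F α) => hF α x0 hx0 x hx
      choose! p hp using this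
      refine ⟨p, fun x hx y hy => ?_⟩
      rw [map_mul, map_inv, ← hp x hx, ← hp y hy]
      group
    · exact ⟨fun _ => 1, fun x hx => absurd ⟨x, hx⟩ hne⟩
  choose p hp using hp
  refine ⟨M, fun α x => c (idx α) (p α x), fun α x y hxy => ?_⟩
  rcases ReflTransGen.cases_head hxy with h | ⟨z, hz, _⟩
  · subst h; simp [nd_self]
  · have hx := hz.1
    have hy := hxy.mem hx
    have key : Chn (nd (S (idx α))) Set.univ (c (idx α)) (e (idx α)) (p α x) (p α y) := by
      refine ReflTransGen.lift (p α) ?_ _ _ hxy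
      rintro a b ⟨ha, hb, hcc, hd⟩
      refine ⟨trivial, trivial, hcc, he _ _ ?_⟩
      rw [← hp α a ha b hb]
      exact hd
    have h1 := hc _ _ _ key
    have h2 : R (idx α) ≤ M := hM ⟨_, rfl⟩
    have h3 := wordNorm_map_le (f (idx α)) (hS _) (hST _) ((p α x)⁻¹ * p α y)
    rw [← hp α x hx y hy] at h3
    exact h3.trans (h1.trans h2)

end Norm

section Pushout

open Monoid Monoid.PushoutI Monoid.PushoutI.NormalWord

variable {C : Type*} [Group C] {ι : Type*} {G : ι → Type*} [∀ b, Group (G b)]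
  {φ : ∀ b, C →* G b} [DecidableEq ι] [∀ i, DecidableEq (G i)]

def Near (i : ι) (τ l : List (Σ i, G i)) : Prop := l = τ ∨ ∃ t, l = ⟨i, t⟩ :: τ

lemma near_rcons {d : Transversal φ} (i : ι) (p : NormalWord.Pair d i) :
    Near i p.tail.toList (NormalWord.rcons i p).toList := by
  simp only [NormalWord.rcons, CoprodI.Word.equivPair_symm, CoprodI.Word.rcons]
  split_ifs
  · exact Or.inl rfl
  · exact Or.inr ⟨_, rfl⟩

lemma near_smul {d : Transversal φ} (i : ι) (g : G i) (w : NormalWord d) :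
    ∃ τ, Near i τ w.toList ∧ Near i τ (of (φ := φ) i g • w).toList := by
  refine ⟨(NormalWord.equivPair i w).tail.toList, ?_, ?_⟩
  · have := near_rcons i (NormalWord.equivPair i w)
    have h : NormalWord.rcons i (NormalWord.equivPair i w) = w :=
      (NormalWord.equivPair i).symm_apply_apply w
    rwa [h] at this
  · rw [summand_smul_def]
    exact near_rcons i _

/-- list of letters of the normal form of `x⁻¹` -/
noncomputable def Lst (d : Transversal φ) (x : PushoutI φ) : List (Σ i, G i) :=
  (x⁻¹ • (NormalWord.empty : NormalWord d)).toList

lemma Lst_one (d : Transversal φ) : Lst d (1 : PushoutI φ) = [] := by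
  simp [Lst, NormalWord.empty, CoprodI.Word.empty]

lemma Lst_step (d : Transversal φ) (x : PushoutI φ) (i : ι) (g : G i) :
    ∃ τ, Near i τ (Lst d x) ∧ Near i τ (Lst d (x * of i g)) := by
  have := near_smul (φ := φ) i g⁻¹ (x⁻¹ • (NormalWord.empty : NormalWord d))
  rw [← mul_smul] at this
  simpa [Lst] using this

lemma Lst_inv (d : Transversal φ) (x : PushoutI φ) :
    ∃ h : C, x⁻¹ = base φ h * ((Lst d x).map fun s => of (φ := φ) s.1 s.2).prod := by
  have h := NormalWord.prod_smul x⁻¹ (NormalWord.empty : NormalWord d)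
  rw [prod_empty, mul_one] at h
  refine ⟨(x⁻¹ • (NormalWord.empty : NormalWord d)).head, ?_⟩
  conv_lhs => rw [← h]
  simp only [NormalWord.prod, CoprodI.Word.prod, map_list_prod, List.map_map, Lst]
  congr 3

lemma Lst_length_step (d : Transversal φ) (x : PushoutI φ) (i : ι) (g : G i) :
    (Lst d (x * of i g)).length ≤ (Lst d x).length + 1 := by
  obtain ⟨τ, h1, h2⟩ := Lst_step d x i g
  rcases h1 with h1 | ⟨t, h1⟩ <;> rcases h2 with h2 | ⟨t', h2⟩ <;> rw [h1, h2] <;> simp <;> omega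

/-- `l` ends with a letter of type `i` followed by `τ` -/
def Ends (i : ι) (τ l : List (Σ i, G i)) : Prop := ∃ p t, l = p ++ ⟨i, t⟩ :: τ

lemma Ends_step (d : Transversal φ) (x : PushoutI φ) (j : ι) (g : G j) (i : ι)
    (τ : List (Σ i, G i)) (h : Ends i τ (Lst d x)) (hl : τ.length < (Lst d (x * of j g)).length) :
    Ends i τ (Lst d (x * of j g)) := by
  obtain ⟨σ, h1, h2⟩ := Lst_step d x j g
  have key : Ends i τ σ → Ends i τ (Lst d (x * of j g)) := by
    rintro ⟨p, t, rfl⟩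
    rcases h2 with h2 | ⟨t', h2⟩
    · exact ⟨p, t, h2⟩
    · exact ⟨_ :: p, t, h2⟩
  obtain ⟨p, t, hp⟩ := h
  rcases h1 with h1 | ⟨s, h1⟩
  · exact key ⟨p, t, by rw [← h1, hp]⟩
  · rw [hp] at h1
    rcases p with _ | ⟨a, p⟩
    · simp only [List.nil_append, List.cons.injEq, Sigma.mk.injEq] at h1
      obtain ⟨⟨rfl, _⟩, rfl⟩ := h1
      rcases h2 with h2 | ⟨t', h2⟩
      · rw [h2] at hl; exact absurd hl (lt_irrefl _)
      · exact ⟨[], t', h2⟩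
    · simp only [List.cons_append, List.cons.injEq] at h1
      exact key ⟨p, t, h1.2.symm⟩

lemma Ends_path (d : Transversal φ) (i : ι) (τ : List (Σ i, G i)) (l : List (PushoutI φ)) :
    ∀ x : PushoutI φ, (∀ s ∈ l, ∃ j g, s = of (φ := φ) j g) → Ends i τ (Lst d x) →
      (∀ p, p <+: l → τ.length < (Lst d (x * p.prod)).length) → Ends i τ (Lst d (x * l.prod)) := by
  induction l with
  | nil => intro x _ h _; simpa using h
  | cons s l ih =>
    intro x hs h hp
    obtain ⟨j, g, rfl⟩ := hs s (by simp)
    rw [List.prod_cons, ← mul_assoc]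
    refine ih _ (fun s' hs' => hs s' (by simp [hs'])) ?_ ?_
    · apply Ends_step d x j g i τ h
      simpa using hp [of j g] (by simp)
    · intro p hpl
      have := hp (of j g :: p) (by simpa using hpl)
      simpa [mul_assoc] using this

lemma closure_union {S : ∀ b, Set (G b)} (hS : ∀ b, Subgroup.closure (S b) = ⊤)
    {T : Set (PushoutI φ)} [Nonempty ι] (hT : ∀ i, of (φ := φ) i '' S i ⊆ T) :
    Subgroup.closure T = ⊤ := by
  rw [eq_top_iff]
  have h1 : ∀ i (g : G i), of (φ := φ) i g ∈ Subgroup.closure T := by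
    intro i g
    have : Subgroup.map (of (φ := φ) i) (Subgroup.closure (S i)) ≤ Subgroup.closure T := by
      rw [MonoidHom.map_closure]
      exact Subgroup.closure_mono (hT i)
    exact this ⟨g, by rw [hS]; trivial, rfl⟩
  rintro x -
  induction x using PushoutI.induction_on with
  | of i g => exact h1 i g
  | base h => rw [← of_apply_eq_base φ (Classical.arbitrary ι)]; exact h1 _ _
  | mul x y hx hy => exact mul_mem hx hy

lemma AD_Lst [Finite ι] [Nonempty ι] (hφ : ∀ b, Function.Injective (φ b)) (d : Transversal φ)
    {S : ∀ b, Set (G b)} (hS : ∀ b, Subgroup.closure (S b) = ⊤)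
    {T : Set (PushoutI φ)} (hT : ∀ i, of (φ := φ) i '' S i ⊆ T)
    (hT2 : ∀ s ∈ T, ∃ j g, s = of (φ := φ) j g) (hTf : T.Finite) {n : ℕ}
    (hA : ∀ j, AD (nd (S j)) Set.univ n) (k : ℕ) :
    AD (nd T) {x | (Lst d x).length ≤ k} n := by
  have hTc := closure_union hS hT
  induction k with
  | zero =>
    have := UAD_cosets (fun j => of (φ := φ) j) (of_injective hφ) S hS hTc hTf hT hA
      (fun _ : Unit => {x | (Lst d x).length ≤ 0}) (fun _ => Classical.arbitrary ι) ?_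
    · intro r
      obtain ⟨R, c, hc⟩ := this r
      exact ⟨R, c (), hc ()⟩
    · rintro - x hx y hy
      obtain ⟨h, hh⟩ := Lst_inv d x
      obtain ⟨h', hh'⟩ := Lst_inv d y
      have hx' : Lst d x = [] := by simpa using hx
      have hy' : Lst d y = [] := by simpa using hy
      rw [hx'] at hh
      rw [hy'] at hh'
      refine ⟨φ _ (h * h'⁻¹), ?_⟩
      rw [of_apply_eq_base, hh, ← inv_inv y, hh']
      simp
  | succ k ih =>
    refine AD_union (ι := {τ : List (Σ i, G i) // τ.length = k} × ι) (nd_self T) (nd_tri hTc) _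
      (fun r => {x | ∃ a ∈ {x | (Lst d x).length ≤ k}, nd T a x ≤ r})
      (fun r => AD.thicken (nd_comm hTc) (nd_self T) (nd_tri hTc) ih r)
      (fun α => {x | ∃ t, Lst d x = ⟨α.2, t⟩ :: α.1.1}) ?_ ?_ ?_
    · refine UAD_cosets (fun j => of (φ := φ) j) (of_injective hφ) S hS hTc hTf hT hA _
        (fun α => α.2) ?_
      rintro ⟨⟨τ, hτ⟩, i⟩ x ⟨t, hx⟩ y ⟨t', hy⟩
      obtain ⟨h, hh⟩ := Lst_inv d x
      obtain ⟨h', hh'⟩ := Lst_inv d y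
      rw [hx] at hh
      rw [hy] at hh'
      refine ⟨φ _ h * t * (φ _ h' * t')⁻¹, ?_⟩
      rw [hh, ← inv_inv y, hh']
      simp only [map_mul, map_inv, of_apply_eq_base, List.map_cons, List.prod_cons]
      group
    · intro r x hx hxY
      have h1 : ¬ (Lst d x).length ≤ k := fun h => hxY ⟨x, h, by simp [nd_self]⟩
      have h2 : (Lst d x).length ≤ k + 1 := hx
      rcases hL : Lst d x with _ | ⟨⟨i, t⟩, τ⟩
      · rw [hL] at h1; simp at h1
      · rw [hL] at h1 h2
        simp only [List.length_cons] at h1 h2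
        exact ⟨⟨⟨τ, by omega⟩, i⟩, t, hL⟩
    · rintro r x y ⟨⟨τ, hτ⟩, i⟩ ⟨⟨τ', hτ'⟩, i'⟩ hx hy ⟨t, hxt⟩ ⟨t', hyt⟩ hxy
      obtain ⟨l, hl1, hl2, hl3⟩ := exists_word hTc (x⁻¹ * y)
      have hlen : l.length ≤ r := hl1.trans_le hxy
      have hE := Ends_path d i τ l x ?_ ⟨[], t, hxt⟩ ?_
      · rw [hl3, mul_inv_cancel_left, hyt] at hE
        obtain ⟨p, s, hp⟩ := hE
        simp only at hp
        have hpl := congrArg List.length hp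
        simp only [List.length_cons, List.length_append, hτ, hτ'] at hpl
        obtain rfl : p = [] := List.length_eq_zero_iff.1 (by omega)
        simp only [List.nil_append, List.cons.injEq, Sigma.mk.injEq] at hp
        obtain ⟨⟨rfl, _⟩, rfl⟩ := hp
        rfl
      · intro s hs
        rcases hl2 s hs with h | h
        · exact hT2 s h
        · obtain ⟨j, g, hg⟩ := hT2 _ h
          exact ⟨j, g⁻¹, by rw [map_inv, ← hg, inv_inv]⟩
      · intro p hp
        by_contra hcon
        rw [hτ, not_lt] at hcon
        refine hx ⟨x * p.prod, hcon, ?_⟩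
        rw [nd_comm hTc]
        have h1 := wordNorm_le (S := T) p (fun g hg => hl2 g (hp.subset hg))
        have h2 := hp.length_le
        simp only [nd, inv_mul_cancel_left]
        omega

end Pushout

end AsdimAux

/-- **Proposition 4.** Let `A ∗_C B` (realized as the pushout of injections
`φ b : C →* G b`, with `A = G true`, `B = G false`) carry the word metric from
`S = S_A ∪ S_B`.  If `asdim A ≤ n` and `asdim B ≤ n`, then for every `m` the subset
`(BA)^m = {b₁a₁⋯b_m a_m : b_j ∈ B, a_j ∈ A}` with the induced metric satisfies
`asdim (BA)^m ≤ n`. -/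
theorem asdim_BA_pow_le {C : Type*} [Group C]
    {G : Bool → Type*} [∀ b, Group (G b)]
    (φ : ∀ b, C →* G b) (hφ : ∀ b, Function.Injective (φ b))
    (S : ∀ b, Finset (G b)) (hS : ∀ b, Subgroup.closure ((S b : Set (G b))) = ⊤)
    (n : ℕ)
    (hA : AsdimOnLE (wordDist ((S true : Set (G true)))) (Set.univ : Set (G true)) n)
    (hB : AsdimOnLE (wordDist ((S false : Set (G false)))) (Set.univ : Set (G false)) n)
    (m : ℕ) :
    AsdimOnLE
      (wordDist ((Monoid.PushoutI.of (φ := φ) true) '' (S true : Set (G true)) ∪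
        (Monoid.PushoutI.of (φ := φ) false) '' (S false : Set (G false))))
      {x : Monoid.PushoutI φ | ∃ (bs : Fin m → G false) (as : Fin m → G true),
        x = (List.ofFn fun j : Fin m =>
          Monoid.PushoutI.of (φ := φ) false (bs j) *
            Monoid.PushoutI.of (φ := φ) true (as j)).prod}
      n := by

  classical
  obtain ⟨d⟩ := Monoid.PushoutI.NormalWord.transversal_nonempty φ hφ
  set T := (Monoid.PushoutI.of (φ := φ) true) '' (S true : Set (G true)) ∪
        (Monoid.PushoutI.of (φ := φ) false) '' (S false : Set (G false)) with hTdef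
  have hT : ∀ i, Monoid.PushoutI.of (φ := φ) i '' (S i : Set (G i)) ⊆ T := by
    intro i
    cases i
    · exact Set.subset_union_right
    · exact Set.subset_union_left
  have hT2 : ∀ s ∈ T, ∃ j g, s = Monoid.PushoutI.of (φ := φ) j g := by
    rintro s (⟨g, _, rfl⟩ | ⟨g, _, rfl⟩)
    exacts [⟨_, g, rfl⟩, ⟨_, g, rfl⟩]
  have hTf : T.Finite := ((S true).finite_toSet.image _).union ((S false).finite_toSet.image _)
  have hAD : ∀ j, AsdimAux.AD (AsdimAux.nd (S j : Set (G j))) Set.univ n := by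
    intro j
    cases j
    · exact AsdimAux.AD_of_asdim (AsdimAux.nd_self _) hB
    · exact AsdimAux.AD_of_asdim (AsdimAux.nd_self _) hA
  have hTc := AsdimAux.closure_union hS hT
  refine AsdimAux.asdim_of_AD (AsdimAux.nd_comm hTc) ?_
  refine (AsdimAux.AD_Lst hφ d hS hT hT2 hTf hAD (2 * m)).mono ?_
  rintro x ⟨bs, as, rfl⟩
  have key : ∀ l : List (Monoid.PushoutI φ),
      (∀ s ∈ l, ∃ b a, s = Monoid.PushoutI.of (φ := φ) false b * Monoid.PushoutI.of true a) →
      (AsdimAux.Lst d l.prod).length ≤ 2 * l.length := by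
    intro l
    induction l using List.reverseRecOn with
    | nil => intro _; simp [AsdimAux.Lst_one]
    | append_singleton l s ih =>
      intro hs
      obtain ⟨b, a, rfl⟩ := hs s (by simp)
      have h1 := ih (fun s hs' => hs s (by simp [hs']))
      have h2 := AsdimAux.Lst_length_step d l.prod false b
      have h3 := AsdimAux.Lst_length_step d (l.prod * Monoid.PushoutI.of false b) true a
      simp only [List.prod_append, List.prod_singleton, List.length_append, List.length_singleton,
        ← mul_assoc]
      omega
  refine (key _ ?_).trans (by simp)
  intro s hs
  rw [List.mem_ofFn] at hs
  obtain ⟨j, rfl⟩ := hs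
  exact ⟨_, _, rfl⟩
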